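/- Let q ∈ (1,2] and let U : ℤ → [0,∞) be a bounded nonnegative potential. There exists a constant c_q > 0, depending only on q, such that for every summable f : ℤ → ℝ with f ≥ 0, ‖H_{q,U}(f)‖_q ≤ c_q ‖f‖_q, where H_{q,U}(f)(x) = (∫₀^∞ Γ_{q,U}(P_t^U f)(x) dt)^{1/2}, Γ_{q,U}(g) = q·g·L_U g − g^{2−q}·L_U(g^q), L_U = L + M_U with M_U multiplication by U, and P_t^U = exp(−tL_U). -/

import Mathlib

open MeasureTheory Real

/-- The kernel `K_s` of the fractional discrete Laplacian on `ℤ`. -/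
noncomputable def Ker (s : ℝ) (m : ℤ) : ℝ :=
  if m = 0 then 0
  else ((4 : ℝ) ^ s * Real.Gamma (1 / 2 + s) / (Real.sqrt Real.pi * |Real.Gamma (-s)|)) *
    (Real.Gamma ((m.natAbs : ℝ) - s) / Real.Gamma ((m.natAbs : ℝ) + 1 + s))

/-- The fractional discrete Laplacian `L = (-Δ)^s` acting pointwise. -/
noncomputable def Lop (s : ℝ) (f : ℤ → ℝ) : ℤ → ℝ :=
  fun x => ∑' y : ℤ, (f x - f y) * Ker s (x - y)

/-- The heat semigroup `P_t = exp (-t L)`, given by the exponential series of the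
bounded operator `-tL` (evaluated pointwise). -/
noncomputable def heat (s t : ℝ) (f : ℤ → ℝ) : ℤ → ℝ :=
  fun x => ∑' n : ℕ, ((-t) ^ n / (n.factorial : ℝ)) * ((Lop s)^[n] f x)

/-- The squared modulus of the gradient, `|∇f|²(x) = Σ_y K_s(y-x) (f x - f y)²`. -/
noncomputable def gradSq (s : ℝ) (f : ℤ → ℝ) (x : ℤ) : ℝ :=
  ∑' y : ℤ, Ker s (y - x) * (f x - f y) ^ 2

/-- The squared modulus of the modified gradient,
`|∇̃f|²(x) = Σ_{y : |f y| < |f x|} K_s(y-x) (f x - f y)²`. -/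
noncomputable def mgradSq (s : ℝ) (f : ℤ → ℝ) (x : ℤ) : ℝ :=
  ∑' y : {y : ℤ // |f y| < |f x|}, Ker s ((y : ℤ) - x) * (f x - f (y : ℤ)) ^ 2

/-- The `ℓ^q` norm on `ℤ` with counting measure (for finite `q`). -/
noncomputable def lqNorm (q : ℝ) (f : ℤ → ℝ) : ℝ :=
  (∑' x : ℤ, |f x| ^ q) ^ (1 / q)

/-- The Schrödinger operator `L_U = L + M_U`, where `M_U` is multiplication by `U`. -/
noncomputable def LopU (s : ℝ) (U : ℤ → ℝ) (f : ℤ → ℝ) : ℤ → ℝ :=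
  fun x => Lop s f x + U x * f x

/-- The pseudo-gradient associated with `L_U`:
`Γ_{q,U}(f) = q f · L_U f - f^{2-q} · L_U (f^q)` (real powers). -/
noncomputable def GammaQU (s q : ℝ) (U : ℤ → ℝ) (f : ℤ → ℝ) : ℤ → ℝ :=
  fun x => q * f x * LopU s U f x - f x ^ (2 - q) * LopU s U (fun y => f y ^ q) x

/-- The Schrödinger semigroup `P_t^U = exp (-t L_U)`, given by the exponential series of
the bounded operator `-t L_U` (evaluated pointwise). -/
noncomputable def heatU (s : ℝ) (U : ℤ → ℝ) (t : ℝ) (f : ℤ → ℝ) : ℤ → ℝ :=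
  fun x => ∑' n : ℕ, ((-t) ^ n / (n.factorial : ℝ)) * ((LopU s U)^[n] f x)

open scoped ENNReal

/-- An even sequence on `ℤ` that is nonincreasing on `ℕ`. -/
structure SymmDecr (k : ℤ → ℝ≥0∞) : Prop where
  even : ∀ m, k (-m) = k m
  anti : ∀ n : ℕ, k (n + 1) ≤ k n

/-- Convolution of `[0,∞]`-valued sequences on `ℤ`. -/
noncomputable def convE (k l : ℤ → ℝ≥0∞) (x : ℤ) : ℝ≥0∞ := ∑' y, k y * l (x - y)

/-- The iterated convolution `k * ⋯ * k`. -/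
noncomputable def convPow (k : ℤ → ℝ≥0∞) : ℕ → ℤ → ℝ≥0∞
  | 0 => Pi.single 0 1
  | n + 1 => convE k (convPow k n)

/-- The operator `g ↦ ∑ y, k y * g (· + y)`. -/
noncomputable def avgE (k g : ℤ → ℝ≥0∞) (x : ℤ) : ℝ≥0∞ := ∑' y, k y * g (x + y)

lemma ENNReal.tsum_int_eq_tsum_nat (g : ℤ → ℝ≥0∞) :
    ∑' m, g m = ∑' n : ℕ, (g n + g (-(n + 1))) := by
  rw [ENNReal.tsum_add]
  exact (HasSum.of_nat_of_neg_add_one (f := g) ENNReal.summable.hasSum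
    ENNReal.summable.hasSum).tsum_eq

lemma ENNReal.mul_add_mul_le_of_le {a b c d : ℝ≥0∞} (hab : b ≤ a) (hcd : d ≤ c) :
    a * d + b * c ≤ a * c + b * d := by
  obtain ⟨a, rfl⟩ := exists_add_of_le hab
  obtain ⟨c, rfl⟩ := exists_add_of_le hcd
  calc (b + a) * d + b * (d + c) ≤ (b + a) * d + b * (d + c) + a * c := le_self_add
    _ = _ := by ring

namespace SymmDecr

variable {k l : ℤ → ℝ≥0∞}

lemma antitone_nat (hk : SymmDecr k) : Antitone (fun n : ℕ => k n) :=
  antitone_nat_of_succ_le fun n => by simpa using hk.anti n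

lemma natAbs_eq (hk : SymmDecr k) (m : ℤ) : k m.natAbs = k m := by
  rcases Int.natAbs_eq m with h | h
  · rw [← h]
  · conv_rhs => rw [h, hk.even]

lemma le_of_natAbs_le (hk : SymmDecr k) {a b : ℤ} (h : a.natAbs ≤ b.natAbs) : k b ≤ k a := by
  rw [← hk.natAbs_eq a, ← hk.natAbs_eq b]
  exact hk.antitone_nat h

lemma single : SymmDecr (Pi.single 0 1) where
  even m := by simp [Pi.single_apply]
  anti n := by
    rw [Pi.single_eq_of_ne (by positivity)]
    exact zero_le

lemma conv (hk : SymmDecr k) (hl : SymmDecr l) : SymmDecr (convE k l) where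
  even m := by
    unfold convE
    rw [← (Equiv.neg ℤ).tsum_eq]
    refine tsum_congr fun y => ?_
    rw [Equiv.neg_apply, hk.even, ← hl.even]
    congr 2
    ring
  anti n := by
    unfold convE
    rw [← (Equiv.subLeft (n : ℤ)).tsum_eq, ← (Equiv.subLeft (n : ℤ)).tsum_eq (fun y => k y * l (n - y)),
      ENNReal.tsum_int_eq_tsum_nat, ENNReal.tsum_int_eq_tsum_nat]
    refine ENNReal.tsum_le_tsum fun i => ?_
    simp only [Equiv.subLeft_apply]
    have h1 : l (n + 1 - (n - i)) = l (i + 1) := by congr 1; ring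
    have h2 : l (n + 1 - (n - -(i + 1))) = l i := by rw [← hl.even]; congr 1; ring
    have h3 : l (n - (n - i)) = l i := by congr 1; ring
    have h4 : l (n - (n - -(i + 1))) = l (i + 1) := by rw [← hl.even]; congr 1; ring
    rw [h1, h2, h3, h4]
    exact ENNReal.mul_add_mul_le_of_le (hk.le_of_natAbs_le (by omega)) (hl.anti i)

lemma pow (hk : SymmDecr k) (n : ℕ) : SymmDecr (convPow k n) := by
  induction n with
  | zero => exact single
  | succ n ih => exact hk.conv ih

end SymmDecr

lemma tsum_convPow (k : ℤ → ℝ≥0∞) (n : ℕ) : ∑' x, convPow k n x = (∑' x, k x) ^ n := by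
  induction n with
  | zero => simp [convPow, tsum_pi_single]
  | succ n ih =>
    unfold convPow convE
    rw [ENNReal.tsum_comm, pow_succ', ← ENNReal.tsum_mul_right]
    refine tsum_congr fun y => ?_
    rw [ENNReal.tsum_mul_left, ← ih]
    congr 1
    exact (Equiv.subRight y).tsum_eq (convPow k n)

lemma iterate_avgE (k g : ℤ → ℝ≥0∞) (n : ℕ) (x : ℤ) :
    (avgE k)^[n] g x = ∑' m, convPow k n m * g (x + m) := by
  induction n generalizing x with
  | zero =>
    rw [tsum_eq_single 0]
    · simp [convPow]
    · intro b hb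
      simp [convPow, Pi.single_eq_of_ne hb]
  | succ n ih =>
    rw [Function.iterate_succ_apply', avgE]
    simp_rw [convPow, convE, ih, ← ENNReal.tsum_mul_left, ← ENNReal.tsum_mul_right]
    rw [ENNReal.tsum_comm (f := fun m y => k y * convPow k n (m - y) * g (x + m))]
    refine tsum_congr fun y => ?_
    rw [← (Equiv.subRight y).tsum_eq]
    refine tsum_congr fun m => ?_
    simp only [Equiv.subRight_apply, mul_assoc]
    congr 3
    ring

lemma sum_mul_le_of_antitone (N : ℕ) {a : ℕ → ℝ≥0∞} (ha : Antitone a) {g : ℕ → ℝ≥0∞} {D : ℝ≥0∞}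
    (hg : ∀ n : ℕ, ∑ i ∈ Finset.range n, g i ≤ n * D) :
    ∑ i ∈ Finset.range N, a i * g i ≤ (∑ i ∈ Finset.range N, a i) * D := by
  induction N generalizing a with
  | zero => simp
  | succ N ih =>
    have h1 : ∀ i ∈ Finset.range N, a i = a N + (a i - a N) := fun i hi =>
      (add_tsub_cancel_of_le (ha (Finset.mem_range.1 hi).le)).symm
    have h2 : ∑ i ∈ Finset.range N, a i * g i =
        a N * ∑ i ∈ Finset.range N, g i + ∑ i ∈ Finset.range N, (a i - a N) * g i := by
      rw [Finset.mul_sum, ← Finset.sum_add_distrib]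
      exact Finset.sum_congr rfl fun i hi => by rw [← add_mul, ← h1 i hi]
    have h3 : ∑ i ∈ Finset.range N, a i = N * a N + ∑ i ∈ Finset.range N, (a i - a N) := by
      rw [Finset.sum_congr rfl h1, Finset.sum_add_distrib]
      simp
    have h4 := ih (a := fun i => a i - a N) fun i j hij => tsub_le_tsub_right (ha hij) _
    rw [Finset.sum_range_succ, Finset.sum_range_succ, h2, h3]
    calc _ = a N * ∑ i ∈ Finset.range (N + 1), g i + ∑ i ∈ Finset.range N, (a i - a N) * g i := by
          rw [Finset.sum_range_succ]; ring
      _ ≤ a N * ((N + 1 : ℕ) * D) + (∑ i ∈ Finset.range N, (a i - a N)) * D := by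
          gcongr
          exact hg _
      _ = _ := by push_cast; ring

lemma SymmDecr.tsum_mul_le {k : ℤ → ℝ≥0∞} (hk : SymmDecr k) {g : ℤ → ℝ≥0∞} {x : ℤ} {D : ℝ≥0∞}
    (hr : ∀ n : ℕ, ∑ i ∈ Finset.range n, g (x + i) ≤ n * D)
    (hl : ∀ n : ℕ, ∑ i ∈ Finset.range n, g (x - i) ≤ n * D) :
    ∑' m, k m * g (x + m) ≤ (∑' m, k m) * (2 * D) := by
  have hk' : ∑' n : ℕ, k n ≤ ∑' m, k m :=
    ENNReal.tsum_comp_le_tsum_of_injective Nat.cast_injective _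
  have key : ∀ g' : ℕ → ℝ≥0∞, (∀ n : ℕ, ∑ i ∈ Finset.range n, g' i ≤ n * D) →
      ∑' n : ℕ, k n * g' n ≤ (∑' m, k m) * D := fun g' h => by
    refine ENNReal.tsum_le_of_sum_range_le fun N => ?_
    refine (sum_mul_le_of_antitone N hk.antitone_nat h).trans ?_
    gcongr
    exact (ENNReal.sum_le_tsum _).trans hk'
  rw [ENNReal.tsum_int_eq_tsum_nat, ENNReal.tsum_add, two_mul, mul_add]
  refine add_le_add (key _ hr) (le_trans ?_ (key _ hl))
  refine le_trans (le_of_eq (tsum_congr fun n => ?_)) (ENNReal.tsum_comp_le_tsum_of_injective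
    (add_left_injective 1) (fun n : ℕ => k n * g (x - n)))
  push_cast
  rw [hk.even, sub_eq_add_neg]

/-- The truncated forward maximal function `max_{n < N + 1} (f x + ⋯ + f (x + n)) / (n + 1)`. -/
noncomputable def fwdMax (f : ℤ → ℝ) (N : ℕ) (x : ℤ) : ℝ :=
  (Finset.range (N + 1)).sup' Finset.nonempty_range_add_one
    fun n => (∑ k ∈ Finset.range (n + 1), f (x + k)) / (n + 1 : ℝ)

lemma le_fwdMax (f : ℤ → ℝ) {n N : ℕ} (h : n ≤ N) (x : ℤ) :
    (∑ k ∈ Finset.range (n + 1), f (x + k)) / (n + 1 : ℝ) ≤ fwdMax f N x :=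
  Finset.le_sup' (fun n : ℕ => (∑ k ∈ Finset.range (n + 1), f (x + k)) / (n + 1 : ℝ))
    (Finset.mem_range.2 (Nat.lt_succ_of_le h))

lemma fwdMax_nonneg {f : ℤ → ℝ} (hf : ∀ x, 0 ≤ f x) (N : ℕ) (x : ℤ) : 0 ≤ fwdMax f N x := by
  have := le_fwdMax f (Nat.zero_le N) x
  simp at this
  exact (hf x).trans this

lemma fwdMax_le {f : ℤ → ℝ} {B : ℝ} (hf : ∀ x, f x ≤ B) (N : ℕ) (x : ℤ) : fwdMax f N x ≤ B := by
  refine Finset.sup'_le _ _ fun n _ => ?_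
  rw [div_le_iff₀ (by positivity)]
  calc _ ≤ ∑ k ∈ Finset.range (n + 1), B := Finset.sum_le_sum fun k _ => hf _
    _ = _ := by simp [mul_comm]

lemma fwdMax_mono (f : ℤ → ℝ) (x : ℤ) : Monotone (fun N => fwdMax f N x) := fun a b hab =>
  Finset.sup'_mono _ (Finset.range_mono (by omega)) _

/-- The truncated Garsia function `max_{n < N + 2} ((f x - l) + ⋯ + (f (x + n - 1) - l))`. -/
noncomputable def garsia (f : ℤ → ℝ) (N : ℕ) (l : ℝ) (x : ℤ) : ℝ :=
  (Finset.range (N + 2)).sup' Finset.nonempty_range_add_one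
    fun n => ∑ k ∈ Finset.range n, (f (x + k) - l)

lemma le_garsia (f : ℤ → ℝ) {n N : ℕ} (h : n ≤ N + 1) (l : ℝ) (x : ℤ) :
    ∑ k ∈ Finset.range n, (f (x + k) - l) ≤ garsia f N l x :=
  Finset.le_sup' (fun n => ∑ k ∈ Finset.range n, (f (x + k) - l))
    (Finset.mem_range.2 (Nat.lt_succ_of_le h))

lemma garsia_nonneg (f : ℤ → ℝ) (N : ℕ) (l : ℝ) (x : ℤ) : 0 ≤ garsia f N l x := by
  simpa using le_garsia f (Nat.zero_le (N + 1)) l x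

lemma garsia_sub_le (f : ℤ → ℝ) (N : ℕ) (l : ℝ) (x : ℤ) :
    garsia f N l x - garsia f N l (x + 1) ≤ if l < fwdMax f N x then f x - l else 0 := by
  have h1 := garsia_nonneg f N l (x + 1)
  obtain ⟨n, hn, h⟩ := Finset.exists_mem_eq_sup' (Finset.nonempty_range_add_one (n := N + 1))
    fun n => ∑ k ∈ Finset.range n, (f (x + k) - l)
  change garsia f N l x = _ at h
  rw [Finset.mem_range] at hn
  split_ifs with hl
  · obtain ⟨m, hm, hlm⟩ := (Finset.lt_sup'_iff _).1 hl
    rw [Finset.mem_range] at hm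
    rw [lt_div_iff₀ (by positivity)] at hlm
    have hpos : 0 < garsia f N l x := by
      refine lt_of_lt_of_le ?_ (le_garsia f (n := m + 1) (by omega) l x)
      rw [Finset.sum_sub_distrib]
      simp
      linarith
    cases n with
    | zero => simp at h; linarith
    | succ n =>
      rw [Finset.sum_range_succ'] at h
      have h2 := le_garsia f (n := n) (N := N) (by omega) l (x + 1)
      have h3 : ∑ k ∈ Finset.range n, (f (x + (k + 1 : ℕ)) - l) =
          ∑ k ∈ Finset.range n, (f (x + 1 + k) - l) :=
        Finset.sum_congr rfl fun k _ => by push_cast; congr 2; ring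
      rw [h3] at h
      simp at h h2
      linarith
  · have : garsia f N l x ≤ 0 := by
      rw [h]
      cases n with
      | zero => simp
      | succ n =>
        have h2 := (le_fwdMax f (n := n) (N := N) (by omega) x).trans (not_lt.1 hl)
        rw [div_le_iff₀ (by positivity)] at h2
        rw [Finset.sum_sub_distrib]
        simp
        linarith
    linarith

lemma garsia_eq_zero {f : ℤ → ℝ} {b : ℤ} (hf : ∀ x, b ≤ x → f x = 0) (N : ℕ) {l : ℝ} (hl : 0 ≤ l) :
    garsia f N l b = 0 := by
  refine le_antisymm (Finset.sup'_le _ _ fun n _ => Finset.sum_nonpos fun k _ => ?_)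
    (garsia_nonneg f N l b)
  rw [hf _ (by omega)]
  linarith

lemma sum_fwdMax_nonneg {f : ℤ → ℝ} {a : ℤ} {n : ℕ} (hf : ∀ x, a + n ≤ x → f x = 0) (N : ℕ)
    {l : ℝ} (hl : 0 ≤ l) :
    0 ≤ ∑ i ∈ Finset.range n, if l < fwdMax f N (a + i) then f (a + i) - l else 0 := by
  have h := Finset.sum_range_sub' (fun i : ℕ => garsia f N l (a + i)) n
  have h2 : ∑ i ∈ Finset.range n, (garsia f N l (a + i) - garsia f N l (a + (i + 1 : ℕ))) ≤
      ∑ i ∈ Finset.range n, if l < fwdMax f N (a + i) then f (a + i) - l else 0 :=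
    Finset.sum_le_sum fun i _ => by
      have := garsia_sub_le f N l (a + i)
      rwa [add_assoc] at this
  have h3 := garsia_nonneg f N l a
  simp only [garsia_eq_zero hf N hl] at h
  rw [h] at h2
  simp at h2
  linarith

lemma integral_Ioo_rpow_mul_sub {q : ℝ} (hq : 1 < q) {M : ℝ} (hM : 0 ≤ M) (c : ℝ) :
    IntegrableOn (fun l => l ^ (q - 2) * (c - l)) (Set.Ioo 0 M) ∧
    ∫ l in Set.Ioo 0 M, l ^ (q - 2) * (c - l) = c * M ^ (q - 1) / (q - 1) - M ^ q / q := by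
  have h1 : IntervalIntegrable (fun l : ℝ => l ^ (q - 2)) volume 0 M :=
    intervalIntegral.intervalIntegrable_rpow' (by linarith)
  have h2 : IntervalIntegrable (fun l : ℝ => l ^ (q - 1)) volume 0 M :=
    intervalIntegral.intervalIntegrable_rpow' (by linarith)
  have h3 : Set.EqOn (fun l : ℝ => c * l ^ (q - 2) - l ^ (q - 1))
      (fun l => l ^ (q - 2) * (c - l)) (Set.Ioo 0 M) := fun l hl => by
    have : l ^ (q - 1) = l ^ (q - 2) * l := by
      rw [← Real.rpow_add_one hl.1.ne']; congr 1; ring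
    simp only [this]
    ring
  have h4 := (h1.const_mul c).sub h2
  rw [intervalIntegrable_iff_integrableOn_Ioo_of_le hM] at h4
  refine ⟨h4.congr_fun h3 measurableSet_Ioo, ?_⟩
  rw [← setIntegral_congr_fun measurableSet_Ioo h3, ← integral_Ioc_eq_integral_Ioo,
    ← intervalIntegral.integral_of_le hM, intervalIntegral.integral_sub (h1.const_mul c) h2,
    intervalIntegral.integral_const_mul, integral_rpow (Or.inl (by linarith)),
    integral_rpow (Or.inl (by linarith))]
  rw [Real.zero_rpow (by linarith), Real.zero_rpow (by linarith)]
  ring_nf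

lemma sum_fwdMax_rpow_le_sum_mul {q : ℝ} (hq : 1 < q) {f : ℤ → ℝ} (hf0 : ∀ x, 0 ≤ f x)
    {a : ℤ} {n : ℕ} (hf : ∀ x, a + n ≤ x → f x = 0) (N : ℕ) :
    ∑ i ∈ Finset.range n, fwdMax f N (a + i) ^ q ≤
      ∑ i ∈ Finset.range n, q / (q - 1) * f (a + i) * fwdMax f N (a + i) ^ (q - 1) := by
  have key : 0 ≤ ∫ l : ℝ, ∑ i ∈ Finset.range n, (Set.Ioo 0 (fwdMax f N (a + i))).indicator
      (fun l => l ^ (q - 2) * (f (a + i) - l)) l := by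
    refine integral_nonneg fun l => ?_
    rcases le_or_gt l 0 with hl | hl
    · exact Finset.sum_nonneg fun i _ => by
        rw [Set.indicator_of_notMem (fun h => hl.not_gt h.1)]
    · have := mul_nonneg (Real.rpow_nonneg hl.le (q - 2)) (sum_fwdMax_nonneg hf N hl.le)
      rw [Finset.mul_sum] at this
      refine this.trans_eq (Finset.sum_congr rfl fun i _ => ?_)
      by_cases h : l < fwdMax f N (a + i) <;> simp [Set.indicator, h, hl]
  rw [integral_finsetSum _ fun i _ => (integrable_indicator_iff measurableSet_Ioo).2
    (integral_Ioo_rpow_mul_sub hq (fwdMax_nonneg hf0 N _) _).1] at key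
  simp_rw [integral_indicator measurableSet_Ioo,
    (integral_Ioo_rpow_mul_sub hq (fwdMax_nonneg hf0 N _) _).2, Finset.sum_sub_distrib] at key
  have hq1 : q - 1 ≠ 0 := by linarith
  have := mul_nonneg (show 0 ≤ q by linarith) key
  rw [mul_sub, Finset.mul_sum, Finset.mul_sum, sub_nonneg] at this
  refine (Finset.sum_congr rfl fun i _ => ?_).trans_le
    (this.trans_eq (Finset.sum_congr rfl fun i _ => ?_)) <;> field_simp

lemma mul_rpow_sub_one_le {q c f M : ℝ} (hq : 1 < q) (hc : 0 < c) (hf : 0 ≤ f) (hM : 0 ≤ M) :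
    c * f * M ^ (q - 1) ≤ M ^ q / 2 + (2 * c) ^ q * f ^ q := by
  have e : ∀ y : ℝ, 0 ≤ y → y * y ^ (q - 1) = y ^ q := fun y hy => by
    rw [mul_comm, ← Real.rpow_add_one' hy (by linarith)]; congr 1; ring
  have hMq := Real.rpow_nonneg hM q
  have hfq := Real.rpow_nonneg hf q
  have hM1 := Real.rpow_nonneg hM (q - 1)
  have hcq := Real.rpow_nonneg (show 0 ≤ 2 * c by linarith) q
  rcases le_total M (2 * c * f) with h | h
  · have h1 : M ^ (q - 1) ≤ (2 * c * f) ^ (q - 1) := Real.rpow_le_rpow hM h (by linarith)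
    have h2 : (2 * c * f) * M ^ (q - 1) ≤ (2 * c) ^ q * f ^ q := by
      rw [← Real.mul_rpow (by linarith) hf, ← e _ (by positivity)]
      gcongr
    have : 0 ≤ c * f * M ^ (q - 1) := by positivity
    nlinarith
  · have h1 : (2 * c * f) * M ^ (q - 1) ≤ M ^ q := by
      rw [← e M hM]; gcongr
    have := mul_nonneg hcq hfq
    linarith

/-- The constant in the maximal inequality. -/
noncomputable def maxConst (q : ℝ) : ℝ := 2 * (2 * (q / (q - 1))) ^ q

lemma maxConst_nonneg {q : ℝ} (hq : 1 < q) : 0 ≤ maxConst q := by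
  have : 0 < q - 1 := by linarith
  unfold maxConst
  positivity

lemma sum_fwdMax_rpow_le_of_support {q : ℝ} (hq : 1 < q) {f : ℤ → ℝ} (hf0 : ∀ x, 0 ≤ f x)
    {a : ℤ} {n : ℕ} (hf : ∀ x, a + n ≤ x → f x = 0) (N : ℕ) :
    ∑ i ∈ Finset.range n, fwdMax f N (a + i) ^ q ≤
      maxConst q * ∑ i ∈ Finset.range n, f (a + i) ^ q := by
  have hc : 0 < q / (q - 1) := div_pos (by linarith) (by linarith)
  have h1 := sum_fwdMax_rpow_le_sum_mul hq hf0 hf N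
  have h2 := Finset.sum_le_sum fun i (_ : i ∈ Finset.range n) =>
    mul_rpow_sub_one_le hq hc (hf0 (a + i)) (fwdMax_nonneg hf0 N (a + i))
  rw [Finset.sum_add_distrib, ← Finset.sum_div, ← Finset.mul_sum] at h2
  unfold maxConst
  linarith

lemma sum_fwdMax_rpow_le {q : ℝ} (hq : 1 < q) {f : ℤ → ℝ} (hf0 : ∀ x, 0 ≤ f x)
    (hf : Summable fun x => f x ^ q) (N : ℕ) (S : Finset ℤ) :
    ∑ x ∈ S, fwdMax f N x ^ q ≤ maxConst q * ∑' x, f x ^ q := by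
  obtain ⟨a, ha⟩ := S.bddBelow
  obtain ⟨b, hb⟩ := S.bddAbove
  set n : ℕ := (b + N + 1 - a).toNat with hn
  set g : ℤ → ℝ := fun x => if x < a + n then f x else 0 with hg
  have hg0 : ∀ x, 0 ≤ g x := fun x => by
    simp only [hg]; split_ifs; exacts [hf0 x, le_rfl]
  have hinj : Function.Injective fun i : ℕ => a + (i : ℤ) := fun i j h => by simpa using h
  have key := sum_fwdMax_rpow_le_of_support hq hg0 (a := a) (n := n)
    (fun x hx => if_neg (by omega)) N
  calc ∑ x ∈ S, fwdMax f N x ^ q = ∑ x ∈ S, fwdMax g N x ^ q := by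
        refine Finset.sum_congr rfl fun x hx => ?_
        have h1 : fwdMax g N x = fwdMax f N x := by
          refine Finset.sup'_congr _ rfl fun m hm => ?_
          congr 1
          refine Finset.sum_congr rfl fun k hk => if_pos ?_
          rw [Finset.mem_range] at hm hk
          have := hb hx
          omega
        rw [h1]
    _ ≤ ∑ x ∈ (Finset.range n).image fun i : ℕ => a + (i : ℤ), fwdMax g N x ^ q := by
        refine Finset.sum_le_sum_of_subset_of_nonneg (fun x hx => ?_)
          fun x _ _ => Real.rpow_nonneg (fwdMax_nonneg hg0 N x) q
        have h1 := ha hx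
        have h2 := hb hx
        exact Finset.mem_image.2 ⟨(x - a).toNat, Finset.mem_range.2 (by omega), by omega⟩
    _ = ∑ i ∈ Finset.range n, fwdMax g N (a + i) ^ q := Finset.sum_image hinj.injOn
    _ ≤ _ := key
    _ ≤ maxConst q * ∑' x, f x ^ q := by
        refine mul_le_mul_of_nonneg_left ?_ (maxConst_nonneg hq)
        rw [← Finset.sum_image (f := fun x => g x ^ q) hinj.injOn]
        refine le_trans (Finset.sum_le_sum fun x _ => Real.rpow_le_rpow (hg0 x) ?_ (by linarith))
          (hf.sum_le_tsum _ fun x _ => Real.rpow_nonneg (hf0 x) q)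
        simp only [hg]; split_ifs; exacts [le_rfl, hf0 x]

lemma exists_fwd_maximal {q : ℝ} (hq : 1 < q) {f : ℤ → ℝ} (hf0 : ∀ x, 0 ≤ f x) {B : ℝ}
    (hB : ∀ x, f x ≤ B) (hf : Summable fun x => f x ^ q) :
    ∃ M : ℤ → ℝ, (∀ x, 0 ≤ M x) ∧ (∀ x, ∀ n : ℕ, ∑ k ∈ Finset.range n, f (x + k) ≤ n * M x) ∧
      ∀ S : Finset ℤ, ∑ x ∈ S, M x ^ q ≤ maxConst q * ∑' x, f x ^ q := by
  have hbdd : ∀ x, BddAbove (Set.range fun N => fwdMax f N x) := fun x =>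
    ⟨B, by rintro _ ⟨N, rfl⟩; exact fwdMax_le hB N x⟩
  refine ⟨fun x => ⨆ N, fwdMax f N x, fun x => Real.iSup_nonneg fun N => fwdMax_nonneg hf0 N x,
    fun x n => ?_, fun S => ?_⟩
  · cases n with
    | zero => simp
    | succ n =>
      have := (le_fwdMax f le_rfl x).trans (le_ciSup (hbdd x) n)
      rw [div_le_iff₀ (by positivity)] at this
      push_cast
      linarith
  · refine le_of_tendsto' (x := Filter.atTop) (tendsto_finsetSum S fun x _ => ?_)
      fun N => sum_fwdMax_rpow_le hq hf0 hf N S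
    exact (tendsto_atTop_ciSup (fwdMax_mono f x) (hbdd x)).rpow_const (Or.inr (by linarith))

/-- The Hardy-Littlewood maximal inequality on `ℤ`. -/
lemma exists_maximal {q : ℝ} (hq : 1 < q) {f : ℤ → ℝ} (hf0 : ∀ x, 0 ≤ f x) {B : ℝ}
    (hB : ∀ x, f x ≤ B) (hf : Summable fun x => f x ^ q) :
    ∃ M : ℤ → ℝ, (∀ x, 0 ≤ M x) ∧ (∀ x, ∀ n : ℕ, ∑ k ∈ Finset.range n, f (x + k) ≤ n * M x) ∧
      (∀ x, ∀ n : ℕ, ∑ k ∈ Finset.range n, f (x - k) ≤ n * M x) ∧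
      ∀ S : Finset ℤ, ∑ x ∈ S, M x ^ q ≤ 2 * maxConst q * ∑' x, f x ^ q := by
  obtain ⟨M, hM0, hM, hMS⟩ := exists_fwd_maximal hq hf0 hB hf
  obtain ⟨M', hM0', hM', hMS'⟩ := exists_fwd_maximal hq (f := fun x => f (-x)) (fun x => hf0 _)
    (fun x => hB _) ((Equiv.neg ℤ).summable_iff.2 hf)
  have hneg : ∑' x, f (-x) ^ q = ∑' x, f x ^ q := (Equiv.neg ℤ).tsum_eq (fun x => f x ^ q)
  rw [hneg] at hMS'
  refine ⟨fun x => max (M x) (M' (-x)), fun x => le_max_of_le_left (hM0 x),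
    fun x n => (hM x n).trans ?_, fun x n => ?_, fun S => ?_⟩
  · gcongr; exact le_max_left _ _
  · have := hM' (-x) n
    calc _ = ∑ k ∈ Finset.range n, f (-(-x + k)) :=
          Finset.sum_congr rfl fun k _ => by congr 1; ring
      _ ≤ n * M' (-x) := this
      _ ≤ _ := by gcongr; exact le_max_right _ _
  · have h1 : ∀ x ∈ S, max (M x) (M' (-x)) ^ q ≤ M x ^ q + M' (-x) ^ q := fun x _ => by
      have := Real.rpow_nonneg (hM0 x) q
      have := Real.rpow_nonneg (hM0' (-x)) q
      rcases max_choice (M x) (M' (-x)) with h | h <;> rw [h] <;> linarith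
    refine (Finset.sum_le_sum h1).trans ?_
    rw [Finset.sum_add_distrib]
    have h2 := hMS S
    have h3 := hMS' (S.map (Equiv.neg ℤ).toEmbedding)
    rw [Finset.sum_map] at h3
    simp only [Equiv.coe_toEmbedding, Equiv.neg_apply] at h3
    linarith
lemma Ker_zero (s : ℝ) : Ker s 0 = 0 := if_pos rfl

lemma Ker_neg (s : ℝ) (m : ℤ) : Ker s (-m) = Ker s m := by simp [Ker]

lemma Ker_succ (s : ℝ) (n : ℕ) : Ker s (n + 1) =
    ((4 : ℝ) ^ s * Real.Gamma (1 / 2 + s) / (Real.sqrt Real.pi * |Real.Gamma (-s)|)) *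
    (Real.Gamma ((n + 1 : ℝ) - s) / Real.Gamma ((n + 1 : ℝ) + 1 + s)) := by
  have h : ((n : ℤ) + 1) ≠ 0 := by positivity
  have h2 : ((n : ℤ) + 1).natAbs = n + 1 := by omega
  rw [Ker, if_neg h, h2]
  push_cast
  rfl

section
variable {s : ℝ} (hs : s ∈ Set.Ioo (0 : ℝ) 1)
include hs

lemma Ker_coeff_nonneg :
    0 ≤ (4 : ℝ) ^ s * Real.Gamma (1 / 2 + s) / (Real.sqrt Real.pi * |Real.Gamma (-s)|) := by
  have := Real.Gamma_pos_of_pos (show 0 < 1 / 2 + s by linarith [hs.1])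
  positivity

lemma Gamma_ratio_pos (n : ℕ) :
    0 < Real.Gamma ((n + 1 : ℝ) - s) / Real.Gamma ((n + 1 : ℝ) + 1 + s) :=
  div_pos (Real.Gamma_pos_of_pos (by linarith [hs.2, n.cast_nonneg (α := ℝ)]))
    (Real.Gamma_pos_of_pos (by linarith [hs.1, n.cast_nonneg (α := ℝ)]))

lemma Gamma_ratio_telescope (n : ℕ) :
    Real.Gamma ((n + 1 : ℝ) - s) / Real.Gamma ((n + 1 : ℝ) + 1 + s) =
      (Real.Gamma ((n + 1 : ℝ) - s) / Real.Gamma ((n + 1 : ℝ) + s) -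
        Real.Gamma (((n + 1 : ℕ) + 1 : ℝ) - s) / Real.Gamma (((n + 1 : ℕ) + 1 : ℝ) + s)) / (2 * s) := by
  obtain ⟨h0, h1⟩ := hs
  have hn := n.cast_nonneg (α := ℝ)
  have e1 : (((n + 1 : ℕ) + 1 : ℝ) - s) = ((n + 1 : ℝ) - s) + 1 := by push_cast; ring
  have e2 : (((n + 1 : ℕ) + 1 : ℝ) + s) = ((n + 1 : ℝ) + s) + 1 := by push_cast; ring
  have e3 : ((n + 1 : ℝ) + 1 + s) = ((n + 1 : ℝ) + s) + 1 := by ring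
  have hp := (Real.Gamma_pos_of_pos (show 0 < (n + 1 : ℝ) + s by linarith)).ne'
  have hp' : (n + 1 : ℝ) + s ≠ 0 := by linarith
  rw [e1, e2, e3, Real.Gamma_add_one hp', Real.Gamma_add_one (show (n + 1 : ℝ) - s ≠ 0 by linarith)]
  field_simp
  ring

lemma Ker_nonneg (m : ℤ) : 0 ≤ Ker s m := by
  have h : ∀ n : ℕ, 0 ≤ Ker s n := fun n => by
    cases n with
    | zero => simp [Ker_zero]
    | succ n =>
      push_cast
      rw [Ker_succ]
      exact mul_nonneg (Ker_coeff_nonneg hs) (Gamma_ratio_pos hs n).le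
  rcases Int.natAbs_eq m with hm | hm <;> rw [hm]
  · exact h _
  · rw [Ker_neg]; exact h _

lemma Ker_succ_anti (n : ℕ) : Ker s (n + 1 + 1) ≤ Ker s (n + 1) := by
  have e := Ker_succ s (n + 1)
  push_cast at e
  rw [e, Ker_succ]
  refine mul_le_mul_of_nonneg_left ?_ (Ker_coeff_nonneg hs)
  have hr := Gamma_ratio_pos hs n
  obtain ⟨h0, h1⟩ := hs
  have hn := n.cast_nonneg (α := ℝ)
  have e1 : ((n + 1 + 1 : ℝ) - s) = ((n + 1 : ℝ) - s) + 1 := by ring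
  have e2 : ((n + 1 + 1 : ℝ) + 1 + s) = ((n + 1 : ℝ) + 1 + s) + 1 := by ring
  rw [e1, e2, Real.Gamma_add_one (by linarith), Real.Gamma_add_one (by linarith),
    mul_div_mul_comm]
  refine mul_le_of_le_one_left hr.le ?_
  rw [div_le_one (by linarith)]
  linarith

lemma Ker_summable : Summable (Ker s) := by
  have hr : Summable fun n : ℕ =>
      Real.Gamma ((n + 1 : ℝ) - s) / Real.Gamma ((n + 1 : ℝ) + 1 + s) := by
    refine summable_of_sum_range_le
      (c := Real.Gamma ((0 + 1 : ℝ) - s) / Real.Gamma ((0 + 1 : ℝ) + s) / (2 * s))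
      (fun n => (Gamma_ratio_pos hs n).le) fun n => ?_
    have h := Finset.sum_range_sub'
      (fun n : ℕ => Real.Gamma ((n + 1 : ℝ) - s) / Real.Gamma ((n + 1 : ℝ) + s)) n
    rw [Finset.sum_congr rfl fun i _ => Gamma_ratio_telescope hs i, ← Finset.sum_div, h]
    have h2 : 0 ≤ Real.Gamma ((n + 1 : ℝ) - s) / Real.Gamma ((n + 1 : ℝ) + s) :=
      div_nonneg (Real.Gamma_pos_of_pos (by linarith [hs.2, n.cast_nonneg (α := ℝ)])).le
        (Real.Gamma_pos_of_pos (by linarith [hs.1, n.cast_nonneg (α := ℝ)])).le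
    have := hs.1
    push_cast
    gcongr
    linarith
  have h1 : Summable fun n : ℕ => Ker s (n + 1) := by
    simp_rw [Ker_succ]; exact hr.mul_left _
  have h2 : Summable fun n : ℕ => Ker s n :=
    (summable_nat_add_iff 1).1 (by simpa using h1)
  exact Summable.of_nat_of_neg h2 (by simpa only [Ker_neg] using h2)

end

open scoped BoundedContinuousFunction

/-- The dominating kernel `K_s + c δ_0`. -/
noncomputable def KerE (s c : ℝ) (m : ℤ) : ℝ≥0∞ :=
  ENNReal.ofReal (Ker s m) + Pi.single (M := fun _ => ℝ≥0∞) 0 (ENNReal.ofReal c) m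

section
variable {s c : ℝ} {U : ℤ → ℝ} (hs : s ∈ Set.Ioo (0 : ℝ) 1)
include hs

lemma summable_Ker_sub (x : ℤ) : Summable fun y => Ker s (x - y) :=
  (Ker_summable hs).comp_injective (Equiv.subLeft x).injective

lemma tsum_Ker_nonneg : 0 ≤ ∑' m, Ker s m := tsum_nonneg (Ker_nonneg hs)

lemma KerE_symmDecr (hc : Ker s 1 ≤ c) : SymmDecr (KerE s c) where
  even m := by simp [KerE, Ker_neg, Pi.single_apply]
  anti n := by
    have h1 : ((n : ℤ) + 1) ≠ 0 := by positivity
    rw [KerE, KerE, Pi.single_eq_of_ne h1, add_zero]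
    cases n with
    | zero =>
      refine le_trans ?_ le_add_self
      simpa using ENNReal.ofReal_le_ofReal hc
    | succ n =>
      refine le_trans (ENNReal.ofReal_le_ofReal ?_) le_self_add
      push_cast
      exact Ker_succ_anti hs n

lemma tsum_KerE (hc : 0 ≤ c) : ∑' m, KerE s c m = ENNReal.ofReal (∑' m, Ker s m + c) := by
  unfold KerE
  rw [ENNReal.tsum_add, tsum_pi_single, ENNReal.ofReal_add (tsum_Ker_nonneg hs) hc,
    ENNReal.ofReal_tsum_of_nonneg (Ker_nonneg hs) (Ker_summable hs)]

lemma summable_Ker_mul (g : ℤ →ᵇ ℝ) (x : ℤ) : Summable fun y => Ker s y * g (x + y) := by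
  refine Summable.of_norm_bounded ((Ker_summable hs).mul_right ‖g‖) fun y => ?_
  rw [norm_mul, Real.norm_of_nonneg (Ker_nonneg hs y)]
  exact mul_le_mul_of_nonneg_left (g.norm_coe_le_norm _) (Ker_nonneg hs y)

lemma LopU_eq (c : ℝ) (U : ℤ → ℝ) (g : ℤ →ᵇ ℝ) (x : ℤ) :
    LopU s U g x = (∑' m, Ker s m + c) * g x -
      (∑' y, Ker s y * g (x + y) + (c - U x) * g x) := by
  have h : Lop s g x = (∑' m, Ker s m) * g x - ∑' y, Ker s y * g (x + y) := by
    rw [Lop, ← (Equiv.addLeft x).tsum_eq, ← tsum_mul_right,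
      ← ((Ker_summable hs).mul_right _).tsum_sub (summable_Ker_mul hs g x)]
    refine tsum_congr fun y => ?_
    rw [Equiv.coe_addLeft, sub_add_cancel_left, Ker_neg]
    ring
  rw [LopU, h]
  ring

lemma norm_step_le (hU : ∀ x, 0 ≤ U x) (hUc : ∀ x, U x ≤ c) (g : ℤ →ᵇ ℝ) (x : ℤ) :
    ‖∑' y, Ker s y * g (x + y) + (c - U x) * g x‖ ≤ (∑' m, Ker s m + c) * ‖g‖ := by
  refine (norm_add_le _ _).trans ?_
  rw [add_mul]
  refine add_le_add ?_ ?_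
  · rw [← tsum_mul_right]
    refine tsum_of_norm_bounded ((Ker_summable hs).mul_right ‖g‖).hasSum fun y => ?_
    rw [norm_mul, Real.norm_of_nonneg (Ker_nonneg hs y)]
    exact mul_le_mul_of_nonneg_left (g.norm_coe_le_norm _) (Ker_nonneg hs y)
  · rw [norm_mul, Real.norm_of_nonneg (sub_nonneg.2 (hUc x))]
    exact mul_le_mul (by linarith [hU x]) (g.norm_coe_le_norm _) (norm_nonneg _)
      ((hU 0).trans (hUc 0))

lemma exists_step (hU : ∀ x, 0 ≤ U x) (hUc : ∀ x, U x ≤ c) :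
    ∃ B : (ℤ →ᵇ ℝ) →L[ℝ] (ℤ →ᵇ ℝ),
      ∀ g x, B g x = ∑' y, Ker s y * g (x + y) + (c - U x) * g x := by
  have hc : 0 ≤ c := (hU 0).trans (hUc 0)
  refine ⟨LinearMap.mkContinuous
    { toFun := fun g => BoundedContinuousFunction.ofNormedAddCommGroupDiscrete _ _
        (norm_step_le hs hU hUc g)
      map_add' := fun g h => ?_
      map_smul' := fun a g => ?_ } (∑' m, Ker s m + c) fun g => ?_, fun g x => rfl⟩
  · ext x
    simp only [BoundedContinuousFunction.coe_add, Pi.add_apply,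
      BoundedContinuousFunction.coe_ofNormedAddCommGroupDiscrete]
    simp_rw [mul_add]
    rw [(summable_Ker_mul hs g x).tsum_add (summable_Ker_mul hs h x)]
    ring
  · ext x
    simp only [BoundedContinuousFunction.coe_smul, smul_eq_mul, RingHom.id_apply,
      BoundedContinuousFunction.coe_ofNormedAddCommGroupDiscrete]
    rw [mul_add, ← tsum_mul_left]
    congr 1
    · exact tsum_congr fun y => by ring
    · ring
  · exact (BoundedContinuousFunction.norm_le
      (mul_nonneg (add_nonneg (tsum_Ker_nonneg hs) hc) (norm_nonneg _))).2
      (norm_step_le hs hU hUc g)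

lemma step_pow_nonneg (hUc : ∀ x, U x ≤ c) {B : (ℤ →ᵇ ℝ) →L[ℝ] (ℤ →ᵇ ℝ)}
    (hB : ∀ g x, B g x = ∑' y, Ker s y * g (x + y) + (c - U x) * g x)
    {f : ℤ →ᵇ ℝ} (hf : ∀ x, 0 ≤ f x) (n : ℕ) (x : ℤ) : 0 ≤ (B ^ n) f x := by
  induction n generalizing x with
  | zero => exact hf x
  | succ n ih =>
    rw [pow_succ', mul_apply_eq_comp, hB]
    exact add_nonneg (tsum_nonneg fun y => mul_nonneg (Ker_nonneg hs y) (ih _))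
      (mul_nonneg (sub_nonneg.2 (hUc x)) (ih _))

lemma ofReal_step_pow_le (hU : ∀ x, 0 ≤ U x) (hUc : ∀ x, U x ≤ c) {B : (ℤ →ᵇ ℝ) →L[ℝ] (ℤ →ᵇ ℝ)}
    (hB : ∀ g x, B g x = ∑' y, Ker s y * g (x + y) + (c - U x) * g x)
    {f : ℤ →ᵇ ℝ} (hf : ∀ x, 0 ≤ f x) (n : ℕ) (x : ℤ) :
    ENNReal.ofReal ((B ^ n) f x) ≤ (avgE (KerE s c))^[n] (fun x => ENNReal.ofReal (f x)) x := by
  induction n generalizing x with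
  | zero => exact le_rfl
  | succ n ih =>
    have h0 := step_pow_nonneg hs hUc hB hf n
    have hc : 0 ≤ c := (hU 0).trans (hUc 0)
    rw [pow_succ', mul_apply_eq_comp, hB, Function.iterate_succ_apply', avgE,
      ENNReal.ofReal_add (tsum_nonneg fun y => mul_nonneg (Ker_nonneg hs y) (h0 _))
        (mul_nonneg (sub_nonneg.2 (hUc x)) (h0 _)),
      ENNReal.ofReal_tsum_of_nonneg (fun y => mul_nonneg (Ker_nonneg hs y) (h0 _))
        (summable_Ker_mul hs _ _)]
    unfold KerE
    simp_rw [add_mul]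
    rw [ENNReal.tsum_add]
    refine add_le_add (ENNReal.tsum_le_tsum fun y => ?_) ?_
    · rw [ENNReal.ofReal_mul (Ker_nonneg hs y)]
      exact mul_le_mul_right (ih _) _
    · rw [tsum_eq_single 0 fun y hy => by rw [Pi.single_eq_of_ne hy, zero_mul],
        Pi.single_eq_same, add_zero, ENNReal.ofReal_mul (sub_nonneg.2 (hUc x))]
      exact mul_le_mul' (ENNReal.ofReal_le_ofReal (by linarith [hU x])) (ih _)

lemma step_pow_le (hU : ∀ x, 0 ≤ U x) (hUc : ∀ x, U x ≤ c) (hc : Ker s 1 ≤ c)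
    {B : (ℤ →ᵇ ℝ) →L[ℝ] (ℤ →ᵇ ℝ)}
    (hB : ∀ g x, B g x = ∑' y, Ker s y * g (x + y) + (c - U x) * g x)
    {f : ℤ →ᵇ ℝ} (hf : ∀ x, 0 ≤ f x) {x : ℤ} {D : ℝ}
    (hr : ∀ n : ℕ, ∑ i ∈ Finset.range n, f (x + i) ≤ n * D)
    (hl : ∀ n : ℕ, ∑ i ∈ Finset.range n, f (x - i) ≤ n * D) (n : ℕ) :
    (B ^ n) f x ≤ (∑' m, Ker s m + c) ^ n * (2 * D) := by
  have hc0 : 0 ≤ c := (hU 0).trans (hUc 0)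
  have hD : 0 ≤ D := by
    have := hr 1
    simp at this
    exact (hf x).trans this
  have hlam : 0 ≤ ∑' m, Ker s m + c := add_nonneg (tsum_Ker_nonneg hs) hc0
  refine (ENNReal.ofReal_le_ofReal_iff (by positivity)).1
    ((ofReal_step_pow_le hs hU hUc hB hf n x).trans ?_)
  rw [iterate_avgE]
  have conv : ∀ (g : ℕ → ℝ), (∀ i, 0 ≤ g i) → (∀ n : ℕ, ∑ i ∈ Finset.range n, g i ≤ n * D) →
      ∀ n : ℕ, ∑ i ∈ Finset.range n, ENNReal.ofReal (g i) ≤ n * ENNReal.ofReal D :=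
    fun g hg h n => by
      rw [← ENNReal.ofReal_sum_of_nonneg fun i _ => hg i, ← ENNReal.ofReal_natCast,
        ← ENNReal.ofReal_mul n.cast_nonneg]
      exact ENNReal.ofReal_le_ofReal (h n)
  refine (((KerE_symmDecr hs hc).pow n).tsum_mul_le (g := fun x => ENNReal.ofReal (f x))
    (conv _ (fun i => hf _) hr) (conv _ (fun i => hf _) hl)).trans_eq ?_
  rw [tsum_convPow, tsum_KerE hs hc0, ENNReal.ofReal_mul (by positivity), ENNReal.ofReal_pow hlam,
    ENNReal.ofReal_mul zero_le_two, ENNReal.ofReal_ofNat]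

end

lemma iterate_LopU {s : ℝ} {U : ℤ → ℝ} {T : (ℤ →ᵇ ℝ) →L[ℝ] (ℤ →ᵇ ℝ)}
    (hT : ∀ g : ℤ →ᵇ ℝ, LopU s U g = ⇑(-(T g))) (f : ℤ →ᵇ ℝ) (n : ℕ) :
    (LopU s U)^[n] f = ⇑(((-T) ^ n) f) := by
  induction n with
  | zero => rfl
  | succ n ih =>
    rw [Function.iterate_succ_apply', ih, hT, pow_succ']
    rfl

section
variable {E : Type*} [NormedAddCommGroup E] [NormedSpace ℝ E]

/-- The orbit `t ↦ exp (t T) f` of the semigroup generated by a bounded operator `T`. -/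
noncomputable def expCurve (T : E →L[ℝ] E) (f : E) (t : ℝ) : E := NormedSpace.exp (t • T) f

lemma expCurve_zero (T : E →L[ℝ] E) (f : E) : expCurve T f 0 = f := by simp [expCurve]

lemma neg_pow_apply_eq_smul (T : E →L[ℝ] E) (f : E) (n : ℕ) :
    ((-T) ^ n) f = (-1 : ℝ) ^ n • (T ^ n) f := by
  rw [neg_pow T]
  rcases Nat.even_or_odd n with h | h <;> simp [h.neg_one_pow]

variable [CompleteSpace E]

lemma hasSum_expCurve (T : E →L[ℝ] E) (f : E) (t : ℝ) (φ : E →L[ℝ] ℝ) :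
    HasSum (fun n : ℕ => t ^ n / (n.factorial : ℝ) * φ ((T ^ n) f)) (φ (expCurve T f t)) := by
  have h := NormedSpace.exp_series_hasSum_exp' (𝕂 := ℝ) (t • T)
  have h2 := (φ.comp (ContinuousLinearMap.apply ℝ E f)).hasSum h
  refine h2.congr_fun fun n => ?_
  have : (φ.comp (ContinuousLinearMap.apply ℝ E f)) ((n.factorial : ℝ)⁻¹ • (t • T) ^ n) =
      (n.factorial : ℝ)⁻¹ * (t ^ n * φ ((T ^ n) f)) := by
    rw [smul_pow, map_smul, map_smul]
    rfl
  rw [this]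
  ring

lemma hasDerivAt_expCurve (T : E →L[ℝ] E) (f : E) (t : ℝ) :
    HasDerivAt (expCurve T f) (T (expCurve T f t)) t :=
  (ContinuousLinearMap.apply ℝ E f).hasFDerivAt.comp_hasDerivAt t
    (hasDerivAt_exp_smul_const' (𝕂 := ℝ) T t)

lemma expCurve_sub_smul_one (B : E →L[ℝ] E) (a : ℝ) (f : E) (t : ℝ) :
    expCurve (B - a • 1) f t = Real.exp (-(t * a)) • expCurve B f t := by
  have e : t • (B - a • (1 : E →L[ℝ] E)) = algebraMap ℝ _ (-(t * a)) + t • B := by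
    rw [smul_sub, Algebra.algebraMap_eq_smul_one, smul_smul, neg_smul]
    abel
  let _ : NormedAlgebra ℚ (E →L[ℝ] E) := NormedAlgebra.restrictScalars ℚ ℝ _
  rw [expCurve, e, NormedSpace.exp_add_of_commute (Algebra.commutes _ _),
    ← NormedSpace.algebraMap_exp_comm, Algebra.algebraMap_eq_smul_one, ← Real.exp_eq_exp_ℝ]
  rfl

end

/-- The Schrödinger semigroup as a differentiable curve of bounded functions. -/
lemma exists_heatU {s c : ℝ} {U : ℤ → ℝ} (hs : s ∈ Set.Ioo (0 : ℝ) 1)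
    (hU : ∀ x, 0 ≤ U x) (hUc : ∀ x, U x ≤ c) (hc : Ker s 1 ≤ c)
    {f : ℤ →ᵇ ℝ} (hf : ∀ x, 0 ≤ f x) :
    ∃ u : ℝ → ℤ →ᵇ ℝ, (∀ t, heatU s U t f = u t) ∧ u 0 = f ∧
      (∀ t x, HasDerivAt (fun t => u t x) (-LopU s U (u t) x) t) ∧
      (∀ x, Continuous fun t => LopU s U (u t) x) ∧
      (∀ t, 0 ≤ t → ∀ x, 0 ≤ u t x) ∧
      ∀ x D, (∀ n : ℕ, ∑ i ∈ Finset.range n, f (x + i) ≤ n * D) →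
        (∀ n : ℕ, ∑ i ∈ Finset.range n, f (x - i) ≤ n * D) → ∀ t, 0 ≤ t → u t x ≤ 2 * D := by
  obtain ⟨B, hB⟩ := exists_step hs hU hUc
  set lam := ∑' m, Ker s m + c with hlam
  set T := B - lam • 1 with hTdef
  have hT : ∀ g : ℤ →ᵇ ℝ, LopU s U g = ⇑(-(T g)) := fun g => by
    ext x
    have : T g = B g - lam • g := rfl
    rw [LopU_eq hs c, ← hB, this]
    simp [hlam]
  let ev : ℤ → (ℤ →ᵇ ℝ) →L[ℝ] ℝ := fun x => BoundedContinuousFunction.evalCLM ℝ x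
  have hexp : ∀ t x, expCurve T f t x = Real.exp (-(t * lam)) * expCurve B f t x := fun t x => by
    rw [hTdef, expCurve_sub_smul_one]
    rfl
  refine ⟨expCurve T f, fun t => ?_, expCurve_zero T f, fun t x => ?_, fun x => ?_,
    fun t ht x => ?_, fun x D hr hl t ht => ?_⟩
  · ext x
    refine (tsum_congr fun n => ?_).trans (hasSum_expCurve T f t (ev x)).tsum_eq
    have h : ((-T) ^ n) f x = (-1) ^ n * (T ^ n) f x := by
      rw [neg_pow_apply_eq_smul]
      rfl
    rw [iterate_LopU hT, h, neg_pow t]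
    change _ = t ^ n / (n.factorial : ℝ) * (T ^ n) f x
    have h1 : ((-1 : ℝ) ^ n) * (-1) ^ n = 1 := by rw [← mul_pow]; simp
    linear_combination (t ^ n / (n.factorial : ℝ) * (T ^ n) f x) * h1
  · rw [hT]
    have h := (ev x).hasFDerivAt.comp_hasDerivAt t (hasDerivAt_expCurve T f t)
    have e : -(-(T (expCurve T f t))) x = ev x (T (expCurve T f t)) := neg_neg _
    rw [e]
    exact h
  · simp_rw [hT]
    have hcont : Continuous (expCurve T f) :=
      continuous_iff_continuousAt.2 fun t => (hasDerivAt_expCurve T f t).continuousAt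
    exact ((ev x).continuous.comp (T.continuous.comp hcont)).neg
  · rw [hexp]
    exact mul_nonneg (Real.exp_pos _).le ((hasSum_expCurve B f t (ev x)).nonneg fun n =>
      mul_nonneg (by positivity) (step_pow_nonneg hs hUc hB hf n x))
  · have h1 := hasSum_expCurve B f t (ev x)
    have h2 : HasSum (fun n : ℕ => (t * lam) ^ n / (n.factorial : ℝ) * (2 * D))
        (Real.exp (t * lam) * (2 * D)) := by
      have := NormedSpace.expSeries_div_hasSum_exp (t * lam)
      rw [← Real.exp_eq_exp_ℝ] at this
      exact this.mul_right _
    have h3 : expCurve B f t x ≤ Real.exp (t * lam) * (2 * D) := hasSum_le (fun n => by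
      rw [mul_pow, mul_div_right_comm, mul_assoc]
      exact mul_le_mul_of_nonneg_left (step_pow_le hs hU hUc hc hB hf hr hl n) (by positivity)) h1 h2
    rw [hexp]
    calc _ ≤ Real.exp (-(t * lam)) * (Real.exp (t * lam) * (2 * D)) := by gcongr
      _ = 2 * D := by rw [← mul_assoc, ← Real.exp_add]; simp

lemma rpow_sub_rpow_le {q a b : ℝ} (hq : 1 < q) (ha : 0 ≤ a) (hb : 0 ≤ b) :
    a ^ q - b ^ q ≤ q * a ^ (q - 1) * (a - b) := by
  rcases ha.eq_or_lt with rfl | ha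
  · rw [Real.zero_rpow (by linarith), Real.zero_rpow (by linarith)]
    linarith [Real.rpow_nonneg hb q]
  · have h := one_add_mul_self_le_rpow_one_add (s := b / a - 1)
      (by linarith [div_nonneg hb ha.le]) hq.le
    rw [add_sub_cancel, Real.div_rpow hb ha.le, le_div_iff₀ (Real.rpow_pos_of_pos ha q)] at h
    have e : a ^ q = a ^ (q - 1) * a := by rw [← Real.rpow_add_one ha.ne']; congr 1; ring
    have : (1 + q * (b / a - 1)) * a ^ q = a ^ q - q * a ^ (q - 1) * (a - b) := by
      rw [e]; field_simp; ring
    linarith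

lemma exists_rpow_bounded {q : ℝ} (hq : 0 ≤ q) (g : ℤ →ᵇ ℝ) :
    ∃ h : ℤ →ᵇ ℝ, ⇑h = fun x => g x ^ q :=
  ⟨BoundedContinuousFunction.ofNormedAddCommGroupDiscrete (fun x => g x ^ q) (‖g‖ ^ q) fun x =>
    (Real.abs_rpow_le_abs_rpow _ _).trans
      (Real.rpow_le_rpow (abs_nonneg _) (g.norm_coe_le_norm x) hq), rfl⟩

/-- The pseudo-gradient without the weight `g ^ (2 - q)`. -/
noncomputable def pseudoGrad (s q : ℝ) (U : ℤ → ℝ) (g : ℤ → ℝ) (x : ℤ) : ℝ :=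
  q * g x ^ (q - 1) * LopU s U g x - LopU s U (fun y => g y ^ q) x

lemma GammaQU_eq {s q : ℝ} (hq : q ∈ Set.Ioc (1 : ℝ) 2) (U : ℤ → ℝ) {g : ℤ → ℝ} {x : ℤ}
    (hg : 0 ≤ g x) : GammaQU s q U g x = g x ^ (2 - q) * pseudoGrad s q U g x := by
  have e : g x ^ (2 - q) * g x ^ (q - 1) = g x := by
    rw [← Real.rpow_add_of_nonneg hg (by linarith [hq.2]) (by linarith [hq.1])]
    norm_num
  rw [GammaQU, pseudoGrad]
  linear_combination (-q * LopU s U g x) * e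

section
variable {s : ℝ} (hs : s ∈ Set.Ioo (0 : ℝ) 1)
include hs

lemma summable_Lop (g : ℤ →ᵇ ℝ) (x : ℤ) : Summable fun y => (g x - g y) * Ker s (x - y) := by
  refine Summable.of_norm_bounded ((summable_Ker_sub hs x).mul_left (‖g‖ + ‖g‖)) fun y => ?_
  rw [norm_mul, Real.norm_of_nonneg (Ker_nonneg hs _)]
  exact mul_le_mul_of_nonneg_right ((norm_sub_le _ _).trans
    (add_le_add (g.norm_coe_le_norm _) (g.norm_coe_le_norm _))) (Ker_nonneg hs _)

lemma pseudoGrad_nonneg {q : ℝ} (hq : 1 < q) {U : ℤ → ℝ} (hU : ∀ x, 0 ≤ U x) {g : ℤ →ᵇ ℝ}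
    (hg : ∀ x, 0 ≤ g x) (x : ℤ) : 0 ≤ pseudoGrad s q U g x := by
  obtain ⟨h, hh⟩ := exists_rpow_bounded (by linarith : 0 ≤ q) g
  have e : g x ^ (q - 1) * g x = g x ^ q := by
    rw [← Real.rpow_add_one' (hg x) (by linarith)]; congr 1; ring
  have key : Lop s (fun y => g y ^ q) x ≤ q * g x ^ (q - 1) * Lop s g x := by
    have hsum := summable_Lop hs h x
    rw [hh] at hsum
    rw [Lop, Lop, ← tsum_mul_left]
    refine hsum.tsum_le_tsum (fun y => ?_) ((summable_Lop hs g x).mul_left _)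
    rw [← mul_assoc]
    exact mul_le_mul_of_nonneg_right (rpow_sub_rpow_le hq (hg x) (hg y)) (Ker_nonneg hs _)
  have h2 : 0 ≤ (q - 1) * (U x * g x ^ q) :=
    mul_nonneg (by linarith) (mul_nonneg (hU x) (Real.rpow_nonneg (hg x) q))
  rw [pseudoGrad, LopU, LopU]
  linear_combination key + h2 - q * U x * e

lemma neg_sum_LopU_le {U : ℤ → ℝ} (hU : ∀ x, 0 ≤ U x) {h : ℤ →ᵇ ℝ} (h0 : ∀ x, 0 ≤ h x)
    {w : ℤ → ℝ} (hw : Summable w) (hhw : ∀ x, h x ≤ w x) (S : Finset ℤ) :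
    -∑ x ∈ S, LopU s U h x ≤ (∑' m, Ker s m) * (∑' x, w x - ∑ x ∈ S, w x) := by
  have hh : Summable h := hw.of_nonneg_of_le h0 hhw
  have hk := tsum_Ker_nonneg hs
  have h1 : ∑ x ∈ S, ∑' y, Ker s y * h (x + y) ≤ (∑' m, Ker s m) * ∑' x, h x := by
    rw [← Summable.tsum_finsetSum fun x _ => summable_Ker_mul hs h x, ← tsum_mul_right]
    refine (summable_sum fun x _ => summable_Ker_mul hs h x).tsum_le_tsum (fun y => ?_)
      ((Ker_summable hs).mul_right _)
    rw [← Finset.mul_sum]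
    refine mul_le_mul_of_nonneg_left ?_ (Ker_nonneg hs y)
    rw [← (Equiv.addRight y).tsum_eq h]
    exact (hh.comp_injective (Equiv.addRight y).injective).sum_le_tsum S fun x _ => h0 _
  have h2 : ∑' x, h x - ∑ x ∈ S, h x ≤ ∑' x, w x - ∑ x ∈ S, w x := by
    have := (hw.sub hh).sum_le_tsum S fun x _ => sub_nonneg.2 (hhw x)
    rw [hw.tsum_sub hh, Finset.sum_sub_distrib] at this
    linarith
  have h3 : ∀ x ∈ S, -LopU s U h x ≤
      ∑' y, Ker s y * h (x + y) - (∑' m, Ker s m) * h x := fun x _ => by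
    rw [LopU_eq hs 0]
    linarith [mul_nonneg (hU x) (h0 x)]
  rw [← Finset.sum_neg_distrib]
  refine (Finset.sum_le_sum h3).trans ?_
  rw [Finset.sum_sub_distrib, ← Finset.mul_sum]
  calc _ ≤ (∑' m, Ker s m) * (∑' x, h x - ∑ x ∈ S, h x) := by linarith
    _ ≤ _ := by gcongr

lemma continuousOn_LopU (U : ℤ → ℝ) {v : ℝ → ℤ →ᵇ ℝ} {A : Set ℝ} {C : ℝ}
    (hv : ∀ x, ContinuousOn (fun t => v t x) A) (hC : ∀ t ∈ A, ∀ x, ‖v t x‖ ≤ C) (x : ℤ) :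
    ContinuousOn (fun t => LopU s U (v t) x) A := by
  simp_rw [LopU_eq hs 0]
  refine ((hv x).const_mul _).sub (ContinuousOn.add ?_ ((hv x).const_mul _))
  refine continuousOn_tsum (fun y => (hv _).const_mul _) ((Ker_summable hs).mul_right C)
    fun y t ht => ?_
  rw [norm_mul, Real.norm_of_nonneg (Ker_nonneg hs y)]
  exact mul_le_mul_of_nonneg_left (hC t ht _) (Ker_nonneg hs y)

end

lemma ContinuousOn.intervalIntegrable_of_Ici {φ : ℝ → ℝ} (hφ : ContinuousOn φ (Set.Ici 0)) {T : ℝ} (hT : 0 ≤ T) :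
    IntervalIntegrable φ volume 0 T :=
  (hφ.mono fun t ht => by rw [Set.uIcc_of_le hT] at ht; exact ht.1).intervalIntegrable

/-- A nonnegative orbit of `-L_U` dominated by a fixed `ℓ^q` function. -/
structure DominatedOrbit (s q : ℝ) (U : ℤ → ℝ) (u : ℝ → ℤ →ᵇ ℝ) (W : ℤ → ℝ) : Prop where
  hasDerivAt : ∀ t x, HasDerivAt (fun t => u t x) (-LopU s U (u t) x) t
  continuous : ∀ x, Continuous fun t => LopU s U (u t) x
  nonneg : ∀ t, 0 ≤ t → ∀ x, 0 ≤ u t x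
  le : ∀ t, 0 ≤ t → ∀ x, u t x ≤ W x
  summable : Summable fun x => W x ^ q

namespace DominatedOrbit

variable {s q : ℝ} {U : ℤ → ℝ} {u : ℝ → ℤ →ᵇ ℝ} {W : ℤ → ℝ}

section
variable (h : DominatedOrbit s q U u W)
include h

lemma continuous_apply (x : ℤ) : Continuous fun t => u t x :=
  continuous_iff_continuousAt.2 fun t => (h.hasDerivAt t x).continuousAt

lemma bound_nonneg (x : ℤ) : 0 ≤ W x := (h.nonneg 0 le_rfl x).trans (h.le 0 le_rfl x)

lemma continuous_deriv_rpow (hq : 1 ≤ q) (x : ℤ) :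
    Continuous fun t => q * u t x ^ (q - 1) * LopU s U (u t) x :=
  (continuous_const.mul ((h.continuous_apply x).rpow_const
    fun t => Or.inr (by linarith))).mul (h.continuous x)

lemma rpow_le (hq : 0 ≤ q) {t : ℝ} (ht : 0 ≤ t) (x : ℤ) : u t x ^ q ≤ W x ^ q :=
  Real.rpow_le_rpow (h.nonneg t ht x) (h.le t ht x) hq

end

variable (hs : s ∈ Set.Ioo (0 : ℝ) 1) (hq : q ∈ Set.Ioc (1 : ℝ) 2) (h : DominatedOrbit s q U u W)
include hs hq h

lemma continuousOn_LopU_rpow (x : ℤ) :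
    ContinuousOn (fun t => LopU s U (fun y => u t y ^ q) x) (Set.Ici 0) := by
  have hq0 : 0 ≤ q := by linarith [hq.1]
  choose v hv using fun t => exists_rpow_bounded hq0 (u t)
  simp_rw [← hv]
  refine continuousOn_LopU hs U (C := ∑' x, W x ^ q) (fun x => ?_) (fun t ht x => ?_) x
  · simp_rw [hv]
    exact ((h.continuous_apply x).rpow_const fun t => Or.inr hq0).continuousOn
  · rw [hv, Real.norm_of_nonneg (Real.rpow_nonneg (h.nonneg t ht x) q)]
    exact (h.rpow_le hq0 ht x).trans
      (h.summable.le_tsum x fun y _ => Real.rpow_nonneg (h.bound_nonneg y) q)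

lemma continuousOn_pseudoGrad (x : ℤ) :
    ContinuousOn (fun t => pseudoGrad s q U (u t) x) (Set.Ici 0) :=
  (h.continuous_deriv_rpow hq.1.le x).continuousOn.sub (h.continuousOn_LopU_rpow hs hq x)

lemma sum_integral_pseudoGrad_le_add (hU : ∀ x, 0 ≤ U x) {T : ℝ} (hT : 0 ≤ T) (S : Finset ℤ) :
    ∑ x ∈ S, ∫ t in (0 : ℝ)..T, pseudoGrad s q U (u t) x ≤
      ∑ x ∈ S, u 0 x ^ q +
        T * ((∑' m, Ker s m) * (∑' x, W x ^ q - ∑ x ∈ S, W x ^ q)) := by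
  have hq0 : 0 ≤ q := by linarith [hq.1]
  have h1 : ∀ x, ∫ t in (0 : ℝ)..T, q * u t x ^ (q - 1) * LopU s U (u t) x =
      u 0 x ^ q - u T x ^ q := fun x => by
    have hd : ∀ t ∈ Set.uIcc 0 T, HasDerivAt (fun t => -(u t x ^ q))
        (q * u t x ^ (q - 1) * LopU s U (u t) x) t := fun t _ =>
      ((h.hasDerivAt t x).rpow_const (Or.inr hq.1.le)).fun_neg.congr_deriv (by ring)
    rw [intervalIntegral.integral_eq_sub_of_hasDerivAt hd
      ((h.continuous_deriv_rpow hq.1.le x).intervalIntegrable _ _)]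
    ring
  have hint : ∀ x, IntervalIntegrable (fun t => LopU s U (fun y => u t y ^ q) x) volume 0 T :=
    fun x => (h.continuousOn_LopU_rpow hs hq x).intervalIntegrable_of_Ici hT
  have h2 : -∑ x ∈ S, ∫ t in (0 : ℝ)..T, LopU s U (fun y => u t y ^ q) x ≤
      T * ((∑' m, Ker s m) * (∑' x, W x ^ q - ∑ x ∈ S, W x ^ q)) := by
    rw [← intervalIntegral.integral_finsetSum fun x _ => hint x, ← intervalIntegral.integral_neg]
    refine (intervalIntegral.integral_mono_on hT
      (ContinuousOn.intervalIntegrable_of_Ici (continuousOn_finsetSum S fun x _ =>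
        h.continuousOn_LopU_rpow hs hq x).neg hT)
      (g := fun _ => (∑' m, Ker s m) * (∑' x, W x ^ q - ∑ x ∈ S, W x ^ q))
      intervalIntegrable_const fun t ht => ?_).trans_eq ?_
    · obtain ⟨v, hv⟩ := exists_rpow_bounded hq0 (u t)
      rw [Pi.neg_apply, ← hv]
      refine neg_sum_LopU_le hs hU (fun x => ?_) h.summable (fun x => ?_) S <;> rw [hv]
      · exact Real.rpow_nonneg (h.nonneg t ht.1 x) q
      · exact h.rpow_le hq0 ht.1 x
    · rw [intervalIntegral.integral_const, sub_zero, smul_eq_mul]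
  have h3 : ∀ x ∈ S, ∫ t in (0 : ℝ)..T, pseudoGrad s q U (u t) x ≤
      u 0 x ^ q - ∫ t in (0 : ℝ)..T, LopU s U (fun y => u t y ^ q) x := fun x _ => by
    unfold pseudoGrad
    rw [intervalIntegral.integral_sub ((h.continuous_deriv_rpow hq.1.le x).intervalIntegrable _ _)
      (hint x), h1]
    linarith [Real.rpow_nonneg (h.nonneg T hT x) q]
  refine (Finset.sum_le_sum h3).trans ?_
  rw [Finset.sum_sub_distrib]
  linarith

lemma integral_pseudoGrad_nonneg (hU : ∀ x, 0 ≤ U x) {T : ℝ} (hT : 0 ≤ T) (x : ℤ) :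
    0 ≤ ∫ t in (0 : ℝ)..T, pseudoGrad s q U (u t) x :=
  intervalIntegral.integral_nonneg hT fun t ht =>
    pseudoGrad_nonneg hs hq.1 hU (h.nonneg t ht.1) x

lemma sum_integral_pseudoGrad_le (hU : ∀ x, 0 ≤ U x) {T : ℝ} (hT : 0 ≤ T) (S : Finset ℤ) :
    ∑ x ∈ S, ∫ t in (0 : ℝ)..T, pseudoGrad s q U (u t) x ≤ ∑' x, u 0 x ^ q := by
  have hu0 : ∀ x, 0 ≤ u 0 x ^ q := fun x => Real.rpow_nonneg (h.nonneg 0 le_rfl x) q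
  have hsum : Summable fun x => u 0 x ^ q :=
    h.summable.of_nonneg_of_le hu0 (h.rpow_le (by linarith [hq.1]) le_rfl)
  have hlim : Filter.Tendsto (fun R : Finset ℤ => ∑' x, u 0 x ^ q +
      T * ((∑' m, Ker s m) * (∑' x, W x ^ q - ∑ x ∈ R, W x ^ q))) Filter.atTop
      (nhds (∑' x, u 0 x ^ q + T * ((∑' m, Ker s m) * (∑' x, W x ^ q - ∑' x, W x ^ q)))) :=
    ((((h.summable.hasSum).const_sub _).const_mul _).const_mul _).const_add _
  rw [sub_self, mul_zero, mul_zero, add_zero] at hlim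
  refine ge_of_tendsto hlim ((Filter.eventually_ge_atTop S).mono fun R hR => ?_)
  calc _ ≤ ∑ x ∈ R, ∫ t in (0 : ℝ)..T, pseudoGrad s q U (u t) x :=
        Finset.sum_le_sum_of_subset_of_nonneg hR fun x _ _ =>
          h.integral_pseudoGrad_nonneg hs hq hU hT x
    _ ≤ _ := h.sum_integral_pseudoGrad_le_add hs hq hU hT R
    _ ≤ _ := by gcongr; exact hsum.sum_le_tsum R fun x _ => hu0 x

lemma sqrt_integral_GammaQU_le (hU : ∀ x, 0 ≤ U x) {T : ℝ} (hT : 0 ≤ T) (x : ℤ) :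
    Real.sqrt (∫ t in (0 : ℝ)..T, GammaQU s q U (u t) x) ^ q ≤
      W x ^ q + ∫ t in (0 : ℝ)..T, pseudoGrad s q U (u t) x := by
  obtain ⟨hq1, hq2⟩ := hq
  have hW := h.bound_nonneg x
  set I := ∫ t in (0 : ℝ)..T, pseudoGrad s q U (u t) x with hI
  have hI0 : 0 ≤ I := h.integral_pseudoGrad_nonneg hs ⟨hq1, hq2⟩ hU hT x
  have hcont := h.continuousOn_pseudoGrad hs ⟨hq1, hq2⟩ x
  have h1 : ∫ t in (0 : ℝ)..T, GammaQU s q U (u t) x ≤ W x ^ (2 - q) * I := by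
    rw [hI, ← intervalIntegral.integral_const_mul]
    have hcongr : ∫ t in (0 : ℝ)..T, GammaQU s q U (u t) x =
        ∫ t in (0 : ℝ)..T, u t x ^ (2 - q) * pseudoGrad s q U (u t) x :=
      intervalIntegral.integral_congr fun t ht => by
        rw [Set.uIcc_of_le hT] at ht
        exact GammaQU_eq ⟨hq1, hq2⟩ U (h.nonneg t ht.1 x)
    rw [hcongr]
    refine intervalIntegral.integral_mono_on hT
      ((ContinuousOn.mul ?_ hcont).intervalIntegrable_of_Ici hT)
      ((hcont.const_mul _).intervalIntegrable_of_Ici hT) fun t ht => ?_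
    · exact ((h.continuous_apply x).rpow_const fun t => Or.inr (by linarith)).continuousOn
    · exact mul_le_mul_of_nonneg_right
        (Real.rpow_le_rpow (h.nonneg t ht.1 x) (h.le t ht.1 x) (by linarith))
        (pseudoGrad_nonneg hs hq1 hU (h.nonneg t ht.1) x)
  have hWq := Real.rpow_nonneg hW q
  calc _ ≤ Real.sqrt (W x ^ (2 - q) * I) ^ q :=
        Real.rpow_le_rpow (Real.sqrt_nonneg _) (Real.sqrt_le_sqrt h1) (by linarith)
    _ = (W x ^ q) ^ ((2 - q) / 2) * I ^ (q / 2) := by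
        rw [Real.sqrt_eq_rpow, ← Real.rpow_mul (mul_nonneg (Real.rpow_nonneg hW _) hI0),
          Real.mul_rpow (Real.rpow_nonneg hW _) hI0, ← Real.rpow_mul hW, ← Real.rpow_mul hW]
        congr 2 <;> ring
    _ ≤ (2 - q) / 2 * W x ^ q + q / 2 * I :=
        Real.geom_mean_le_arith_mean2_weighted (by linarith) (by linarith) hWq hI0 (by ring)
    _ ≤ _ := by nlinarith

lemma sum_sqrt_integral_GammaQU_le (hU : ∀ x, 0 ≤ U x) (S : Finset ℤ) :
    ∑ x ∈ S, Real.sqrt (∫ t in Set.Ioi (0 : ℝ), GammaQU s q U (u t) x) ^ q ≤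
      ∑' x, W x ^ q + ∑' x, u 0 x ^ q := by
  classical
  have hq0 : 0 < q := by linarith [hq.1]
  set P : ℤ → Prop := fun x => IntegrableOn (fun t => GammaQU s q U (u t) x) (Set.Ioi 0)
  have hlim : Filter.Tendsto (fun T : ℝ => ∑ x ∈ S, if P x then
      Real.sqrt (∫ t in (0 : ℝ)..T, GammaQU s q U (u t) x) ^ q else 0) Filter.atTop
      (nhds (∑ x ∈ S, Real.sqrt (∫ t in Set.Ioi (0 : ℝ), GammaQU s q U (u t) x) ^ q)) := by
    refine tendsto_finsetSum S fun x _ => ?_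
    by_cases hx : P x
    · simp_rw [if_pos hx]
      exact (intervalIntegral_tendsto_integral_Ioi 0 hx Filter.tendsto_id).sqrt.rpow_const
        (Or.inr hq0.le)
    · simp_rw [if_neg hx]
      rw [integral_undef hx, Real.sqrt_zero, Real.zero_rpow hq0.ne']
      exact tendsto_const_nhds
  refine le_of_tendsto hlim ((Filter.eventually_ge_atTop 0).mono fun T hT => ?_)
  calc _ ≤ ∑ x ∈ S, (W x ^ q + ∫ t in (0 : ℝ)..T, pseudoGrad s q U (u t) x) := by
        refine Finset.sum_le_sum fun x _ => ?_
        have h1 := h.sqrt_integral_GammaQU_le hs hq hU hT x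
        split_ifs
        · exact h1
        · exact (Real.rpow_nonneg (Real.sqrt_nonneg _) q).trans h1
    _ ≤ _ := by
        rw [Finset.sum_add_distrib]
        exact add_le_add
          (h.summable.sum_le_tsum S fun x _ => Real.rpow_nonneg (h.bound_nonneg x) q)
          (h.sum_integral_pseudoGrad_le hs hq hU hT S)

end DominatedOrbit

/-- For every `q ∈ (1,2]` there is `c_q > 0`, depending only on `q`, such that for every
`s ∈ (0,1)`, every bounded nonnegative potential `U` and every summable nonnegative `f`,
`‖H_{q,U} f‖_q ≤ c_q ‖f‖_q`, where
`H_{q,U} f x = (∫₀^∞ Γ_{q,U}(P_t^U f)(x) dt)^{1/2}`. -/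
theorem lq_bound_HqU (q : ℝ) (hq : q ∈ Set.Ioc (1 : ℝ) 2) :
    ∃ c : ℝ, 0 < c ∧ ∀ s : ℝ, s ∈ Set.Ioo (0 : ℝ) 1 →
      ∀ U : ℤ → ℝ, (∀ x, 0 ≤ U x) → (∃ M : ℝ, ∀ x, U x ≤ M) →
        ∀ f : ℤ → ℝ, Summable f → (∀ x, 0 ≤ f x) →
          lqNorm q (fun x => Real.sqrt (∫ t in Set.Ioi (0 : ℝ),
            GammaQU s q U (heatU s U t f) x)) ≤ c * lqNorm q f := by
  have hq0 : 0 < q := by linarith [hq.1]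
  have hC : 0 < 2 ^ q * (2 * maxConst q) + 1 := by
    have := maxConst_nonneg hq.1
    positivity
  refine ⟨(2 ^ q * (2 * maxConst q) + 1) ^ (1 / q), by positivity,
    fun s hs U hU ⟨M, hM⟩ f hf hf0 => ?_⟩
  have hfle : ∀ x, f x ≤ ∑' y, f y := fun x => hf.le_tsum x fun y _ => hf0 y
  have hfq : Summable fun x => f x ^ q := by
    refine (hf.mul_left ((∑' y, f y) ^ (q - 1))).of_nonneg_of_le
      (fun x => Real.rpow_nonneg (hf0 x) q) fun x => ?_
    calc f x ^ q = f x ^ (q - 1) * f x := by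
          rw [← Real.rpow_add_one' (hf0 x) (by linarith)]; congr 1; ring
      _ ≤ _ := mul_le_mul_of_nonneg_right
          (Real.rpow_le_rpow (hf0 x) (hfle x) (by linarith [hq.1])) (hf0 x)
  have hF : 0 ≤ ∑' x, f x ^ q := tsum_nonneg fun x => Real.rpow_nonneg (hf0 x) q
  obtain ⟨D, hD0, hr, hl, hDS⟩ := exists_maximal hq.1 hf0 hfle hfq
  obtain ⟨g, rfl⟩ : ∃ g : ℤ →ᵇ ℝ, ⇑g = f :=
    ⟨BoundedContinuousFunction.ofNormedAddCommGroupDiscrete f (∑' y, f y) fun x => by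
      rw [Real.norm_of_nonneg (hf0 x)]; exact hfle x, rfl⟩
  obtain ⟨u, hu, hu0, hd, hcont, hnonneg, hle⟩ := exists_heatU hs hU
    (fun x => (hM x).trans (le_max_left M (Ker s 1))) (le_max_right M (Ker s 1)) hf0
  have hDq : ∀ x, 0 ≤ D x ^ q := fun x => Real.rpow_nonneg (hD0 x) q
  have e : (fun x => (2 * D x) ^ q) = fun x => 2 ^ q * D x ^ q :=
    funext fun x => Real.mul_rpow zero_le_two (hD0 x)
  have h : DominatedOrbit s q U u fun x => 2 * D x :=
    { hasDerivAt := hd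
      continuous := hcont
      nonneg := hnonneg
      le := fun t ht x => hle x (D x) (hr x) (hl x) t ht
      summable := by rw [e]; exact (summable_of_sum_le hDq hDS).mul_left _ }
  have key : ∑' x, |Real.sqrt (∫ t in Set.Ioi (0 : ℝ), GammaQU s q U (heatU s U t g) x)| ^ q ≤
      (2 ^ q * (2 * maxConst q) + 1) * ∑' x, |g x| ^ q := by
    simp_rw [hu, abs_of_nonneg (Real.sqrt_nonneg _), abs_of_nonneg (hf0 _)]
    refine Real.tsum_le_of_sum_le (fun x => Real.rpow_nonneg (Real.sqrt_nonneg _) q) fun S =>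
      (h.sum_sqrt_integral_GammaQU_le hs hq hU S).trans ?_
    rw [e, tsum_mul_left, hu0, add_mul, one_mul, mul_assoc]
    gcongr
    exact Real.tsum_le_of_sum_le hDq hDS
  rw [lqNorm, lqNorm, ← Real.mul_rpow hC.le (tsum_nonneg fun x => Real.rpow_nonneg (abs_nonneg _) q)]
  exact Real.rpow_le_rpow (tsum_nonneg fun x => Real.rpow_nonneg (abs_nonneg _) q) key
    (by positivity)
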